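/- Let μ be an absolutely continuous probability measure on S¹. The logarithmic map log_μ, which sends each probability measure ν on S¹ to the (μ̃-a.e. unique) lift T̃^ν ∈ L²(μ̃) of the optimal transport map from μ to ν, is a homeomorphism from the space of probability measures on S¹ equipped with the W₂ distance onto its image log_μ(𝒲₂(S¹)) ⊂ L²(μ̃), with continuous inverse exp_μ(T̃) = (exp_c ∘ T̃ ∘ log_c) # μ. -/

import Mathlib

open MeasureTheory Real Set Filter Topology

noncomputable section

instance : Fact (0 < 2 * Real.pi) := ⟨by positivity⟩

/-- The circle `ℝ / 2πℤ`. -/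
abbrev S1 : Type := AddCircle (2 * Real.pi)

/-- The quotient projection `exp_c : ℝ → S¹`. -/
def expc (x : ℝ) : S1 := (x : S1)

/-- The canonical right inverse `log_c : S¹ → [0, 2π)`. -/
def logc (z : S1) : ℝ := (AddCircle.equivIco (2 * Real.pi) 0 z : ℝ)

/-- Squared 2-Wasserstein distance: infimum of `∫ d(x,y)² dγ` over couplings `γ`. -/
def W2sq {X : Type*} [MeasurableSpace X] [PseudoMetricSpace X]
    (μ ν : Measure X) : ℝ :=
  sInf { c : ℝ | ∃ γ : Measure (X × X), IsProbabilityMeasure γ ∧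
      γ.map Prod.fst = μ ∧ γ.map Prod.snd = ν ∧
      c = ∫ p, dist p.1 p.2 ^ 2 ∂γ }

/-- `T` is an optimal transport map from `μ` to `ν`. -/
def IsOTM (μ ν : Measure S1) (T : S1 → S1) : Prop :=
  Measurable T ∧ μ.map T = ν ∧ (∫ z, dist z (T z) ^ 2 ∂μ) = W2sq μ ν

/-- `μ̃`, the pushforward of a measure on `S¹` to `[0, 2π) ⊆ ℝ` via `log_c`. -/
def tilde (μ : Measure S1) : Measure ℝ := μ.map logc

/-- The periodic cumulative distribution function of a (periodicised) measure on `[0,2π)`: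
`F(x) = μ̃([0,x))` for `x ∈ [0,2π]`, extended by `F(x + 2π) = F(x) + 1`. -/
def cdf (μt : Measure ℝ) (x : ℝ) : ℝ :=
  ⌊x / (2 * π)⌋ + (μt (Set.Ico 0 (Int.fract (x / (2 * π)) * (2 * π)))).toReal

/-- The quantile function (generalized inverse) of the periodic cdf. -/
def qf (μt : Measure ℝ) (u : ℝ) : ℝ := sInf { x : ℝ | u ≤ cdf μt x }

/-- The cost `C_{[μ,ν]}(θ) = ∫₀¹ (F_μ̃⁻(u) − F_ν̃⁻(u−θ))² du`. -/
def cost (μ ν : Measure S1) (θ : ℝ) : ℝ :=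
  ∫ u in (0:ℝ)..1, (qf (tilde μ) u - qf (tilde ν) (u - θ)) ^ 2


/-- `T̃ : ℝ → ℝ` is a lift of an optimal transport map from `μ` to `ν`: it is monotone
nondecreasing, `2π`-periodic-equivariant, has zero average displacement over one period,
and `exp_c ∘ T̃ ∘ log_c` is an optimal transport map from `μ` to `ν`. -/
def IsOTMLift (μ ν : Measure S1) (T : ℝ → ℝ) : Prop :=
  Monotone T ∧ (∀ x : ℝ, T (x + 2 * π) = T x + 2 * π) ∧
    (∫ u in (0:ℝ)..(2 * π), (T u - u)) = 0 ∧
    IsOTM μ ν (fun z => expc (T (logc z)))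

lemma expc_logc (z : S1) : expc (logc z) = z := AddCircle.coe_equivIco

lemma logc_mem (z : S1) : logc z ∈ Ico 0 (2 * π) := by
  have h : logc z ∈ Ico 0 (0 + 2 * π) := (AddCircle.equivIco (2 * π) 0 z).2
  rwa [zero_add] at h

lemma logc_injective : Function.Injective logc :=
  Function.LeftInverse.injective expc_logc

lemma measurable_logc : Measurable logc :=
  measurable_subtype_coe.comp (AddCircle.measurableEquivIco (2 * π) 0).measurable

lemma continuous_expc : Continuous expc := AddCircle.continuous_mk' _

lemma measurable_expc : Measurable expc := continuous_expc.measurable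

lemma expc_eq_iff {x y : ℝ} : expc x = expc y ↔ ∃ k : ℤ, y = x + k * (2 * π) := by
  rw [eq_comm, ← sub_eq_zero]
  change ((y : S1) - (x : S1) = 0) ↔ _
  rw [← AddCircle.coe_sub, AddCircle.coe_eq_zero_iff]
  simp only [zsmul_eq_mul]
  exact exists_congr fun k => ⟨fun h => by linarith, fun h => by linarith⟩

lemma dist_expc_le (x y : ℝ) : dist (expc x) (expc y) ≤ |x - y| := by
  rw [dist_eq_norm]
  change ‖((x : S1) - (y : S1))‖ ≤ _
  rw [← AddCircle.coe_sub]
  exact QuotientAddGroup.norm_mk_le_norm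

/-- Every point of the circle has a representative realising its distance to `expc y`. -/
lemma exists_rep (w : S1) (y : ℝ) : ∃ x : ℝ, expc x = w ∧ dist w (expc y) = |x - y| := by
  set t := logc w with ht
  refine ⟨t - round ((2 * π)⁻¹ * (t - y)) * (2 * π), ?_, ?_⟩
  · rw [← expc_logc w, expc_eq_iff]
    exact ⟨round ((2 * π)⁻¹ * (t - y)), by rw [← ht]; ring⟩
  · rw [← expc_logc w, dist_eq_norm, ← ht]
    change ‖((t : S1) - (y : S1))‖ = _
    rw [← AddCircle.coe_sub, AddCircle.norm_eq]
    congr 1; ring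

lemma dist_le_pi (z w : S1) : dist z w ≤ π := by
  rw [dist_eq_norm]
  refine (AddCircle.norm_le_half_period (2 * π) (by positivity)).trans (le_of_eq ?_)
  rw [abs_of_pos (by positivity)]; ring

instance (μ : Measure S1) [IsProbabilityMeasure μ] : IsProbabilityMeasure (tilde μ) :=
  Measure.isProbabilityMeasure_map measurable_logc.aemeasurable

lemma map_expc_tilde (μ : Measure S1) : (tilde μ).map expc = μ := by
  rw [tilde, Measure.map_map measurable_expc measurable_logc]
  simp [Function.comp_def, expc_logc]

lemma nullSingletonClass_of_absolutelyContinuous {μ : Measure S1} (h : μ ≪ volume) :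
    NullSingletonClass μ := by
  refine ⟨fun z => h ?_⟩
  rw [← (AddCircle.measurePreserving_mk (2 * π) 0).measure_preimage
    (measurableSet_singleton z).nullMeasurableSet]
  refine nonpos_iff_eq_zero.1 ((Measure.restrict_apply_le _ _).trans (le_of_eq ?_))
  refine Set.Countable.measure_zero ?_ _
  refine (countable_range fun k : ℤ => logc z + k * (2 * π)).mono fun x hx => ?_
  obtain ⟨k, hk⟩ := expc_eq_iff.1 ((expc_logc z).trans (show z = expc x from hx.symm))
  exact ⟨k, hk.symm⟩

lemma nullSingletonClass_tilde (μ : Measure S1) [NullSingletonClass μ] :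
    NullSingletonClass (tilde μ) := by
  refine ⟨fun x => ?_⟩
  rw [tilde, Measure.map_apply measurable_logc (measurableSet_singleton x)]
  exact ((countable_singleton x).preimage logc_injective).measure_zero μ

/-- Monotone equivariant maps `ℝ → ℝ` with zero average displacement. -/
structure IsCenteredLift (T : ℝ → ℝ) : Prop where
  mono : Monotone T
  add_period : ∀ x, T (x + 2 * π) = T x + 2 * π
  average : ∫ u in (0:ℝ)..(2 * π), (T u - u) = 0

/-- The Kantorovich potential on the source side of a monotone map. -/
def pot (T : ℝ → ℝ) (x : ℝ) : ℝ := ∫ u in (0:ℝ)..x, (u - T u)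

section Potentials

variable {T : ℝ → ℝ}

lemma intervalIntegrable_disp (hT : Monotone T) (a b : ℝ) :
    IntervalIntegrable (fun u => u - T u) volume a b :=
  continuous_id.intervalIntegrable _ _ |>.sub hT.intervalIntegrable

lemma pot_sub (hT : Monotone T) (a b : ℝ) : pot T b - pot T a = ∫ u in a..b, (u - T u) :=
  intervalIntegral.integral_interval_sub_left (intervalIntegrable_disp hT _ _)
    (intervalIntegrable_disp hT _ _)

lemma integral_id_sub (a b : ℝ) (c : ℝ) :
    ∫ u in a..b, (u - c) = (b - c) ^ 2 / 2 - (a - c) ^ 2 / 2 := by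
  rw [intervalIntegral.integral_sub (by simp) (by simp)]
  simp; ring

lemma pot_sub_le (hT : Monotone T) (x y : ℝ) :
    pot T y - pot T x ≤ (y - T x) ^ 2 / 2 - (x - T x) ^ 2 / 2 := by
  rw [pot_sub hT, ← integral_id_sub]
  have hi := intervalIntegrable_disp hT
  have hj : ∀ a b : ℝ, IntervalIntegrable (fun u => u - T x) volume a b := fun a b =>
    (by fun_prop : Continuous fun u : ℝ => u - T x).intervalIntegrable _ _
  rcases le_total x y with h | h
  · exact intervalIntegral.integral_mono_on h (hi _ _) (hj _ _)
      fun u hu => by linarith [hT hu.1]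
  · rw [intervalIntegral.integral_symm, intervalIntegral.integral_symm y x]
    exact neg_le_neg (intervalIntegral.integral_mono_on h (hj _ _) (hi _ _)
      fun u hu => by linarith [hT hu.2])

lemma continuous_pot (hT : Monotone T) : Continuous (pot T) :=
  intervalIntegral.continuous_primitive (intervalIntegrable_disp hT) 0

end Potentials

namespace IsCenteredLift

variable {T : ℝ → ℝ} (h : IsCenteredLift T)
include h

lemma periodic_disp : Function.Periodic (fun u => u - T u) (2 * π) := fun u => by
  simp [h.add_period]

lemma integral_disp (a : ℝ) : ∫ u in a..(a + 2 * π), (u - T u) = 0 := by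
  rw [h.periodic_disp.intervalIntegral_add_eq a 0, zero_add, ← neg_eq_zero,
    ← intervalIntegral.integral_neg]
  simpa using h.average

lemma periodic_pot : Function.Periodic (pot T) (2 * π) := fun x => by
  rw [← sub_eq_zero, pot_sub h.mono, h.integral_disp]

lemma pot_logc_expc (x : ℝ) : pot T (logc (expc x)) = pot T x := by
  obtain ⟨k, hk⟩ := expc_eq_iff.1 (expc_logc (expc x)).symm
  rw [hk]
  exact h.periodic_pot.int_mul k _

end IsCenteredLift

/-- The Kantorovich potential on the target side, the `c`-transform of `pot T`. -/
def conj (T : ℝ → ℝ) (z : S1) : ℝ := ⨅ w : S1, (dist w z ^ 2 / 2 - pot T (logc w))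

/-- The defect of the pair `(x, y)` in the duality inequality of the potentials of `T`. -/
def slack (T : ℝ → ℝ) (x y : ℝ) : ℝ := (x - y) ^ 2 / 2 - pot T x - conj T (expc y)

section Potentials

variable {T : ℝ → ℝ}

lemma exists_abs_pot_logc_le (hT : Monotone T) : ∃ C, ∀ w : S1, |pot T (logc w)| ≤ C := by
  obtain ⟨C, hC⟩ := (isCompact_Icc (a := (0 : ℝ)) (b := 2 * π)).exists_bound_of_continuousOn
    (continuous_pot hT).continuousOn
  exact ⟨C, fun w => hC _ (Ico_subset_Icc_self (logc_mem w))⟩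

lemma pot_add_conj_le (hT : Monotone T) (w z : S1) :
    pot T (logc w) + conj T z ≤ dist w z ^ 2 / 2 := by
  obtain ⟨C, hC⟩ := exists_abs_pot_logc_le hT
  have hb : BddBelow (range fun w : S1 => dist w z ^ 2 / 2 - pot T (logc w)) := by
    refine ⟨-C, ?_⟩
    rintro _ ⟨w, rfl⟩
    have := (abs_le.1 (hC w)).2
    have : 0 ≤ dist w z ^ 2 / 2 := by positivity
    linarith
  have : conj T z ≤ dist w z ^ 2 / 2 - pot T (logc w) := ciInf_le hb w
  linarith

lemma lipschitzWith_conj (hT : Monotone T) : LipschitzWith ⟨π, pi_pos.le⟩ (conj T) := by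
  refine LipschitzWith.of_le_add_mul _ fun z z' => ?_
  rw [← sub_le_iff_le_add]
  refine le_ciInf fun w => ?_
  have h1 := pot_add_conj_le hT w z
  have h2 : dist w z ≤ dist w z' + dist z z' := by
    rw [dist_comm z z']; exact dist_triangle _ _ _
  have h3 := dist_le_pi w z
  have h4 := dist_le_pi w z'
  have h5 : dist w z ^ 2 / 2 - dist w z' ^ 2 / 2 ≤ π * dist z z' := by
    have h6 : (0 : ℝ) ≤ dist w z := dist_nonneg
    have h7 : (0 : ℝ) ≤ dist w z' := dist_nonneg
    have h8 : (0 : ℝ) ≤ dist z z' := dist_nonneg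
    nlinarith [mul_le_mul_of_nonneg_right (sub_le_iff_le_add'.2 h2) (add_nonneg h6 h7),
      mul_le_mul_of_nonneg_left (add_le_add h3 h4) h8]
  change _ - π * _ ≤ _
  linarith

lemma continuous_conj (hT : Monotone T) : Continuous (conj T) := (lipschitzWith_conj hT).continuous

lemma measurable_lift (hT : Monotone T) : Measurable fun z : S1 => T (logc z) :=
  hT.measurable.comp measurable_logc

lemma measurable_map (hT : Monotone T) : Measurable fun z : S1 => expc (T (logc z)) :=
  measurable_expc.comp (measurable_lift hT)

lemma integrable_pot (hT : Monotone T) (μ : Measure S1) [IsFiniteMeasure μ] :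
    Integrable (fun z => pot T (logc z)) μ := by
  obtain ⟨C, hC⟩ := exists_abs_pot_logc_le hT
  exact Integrable.of_bound
    ((continuous_pot hT).measurable.comp measurable_logc).aestronglyMeasurable C
    (ae_of_all _ hC)

lemma integrable_conj (hT : Monotone T) (μ : Measure S1) [IsFiniteMeasure μ] :
    Integrable (conj T) μ :=
  (continuous_conj hT).integrable_of_hasCompactSupport (HasCompactSupport.of_compactSpace _)

end Potentials

namespace IsCenteredLift

variable {T : ℝ → ℝ} (h : IsCenteredLift T)
include h

lemma pot_add_conj_le_sq (x y : ℝ) : pot T x + conj T (expc y) ≤ (x - y) ^ 2 / 2 := by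
  have h1 := pot_add_conj_le h.mono (expc x) (expc y)
  rw [h.pot_logc_expc] at h1
  have h2 := pow_le_pow_left₀ dist_nonneg (dist_expc_le x y) 2
  rw [sq_abs] at h2
  linarith

lemma slack_nonneg (x y : ℝ) : 0 ≤ slack T x y := by
  have := h.pot_add_conj_le_sq x y
  unfold slack; linarith

lemma conj_apply (x : ℝ) : pot T x + conj T (expc (T x)) = (x - T x) ^ 2 / 2 := by
  refine le_antisymm (h.pot_add_conj_le_sq x _) ?_
  rw [← sub_le_iff_le_add']
  refine le_ciInf fun w => ?_
  obtain ⟨x', rfl, hd⟩ := exists_rep w (T x)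
  rw [hd, sq_abs, h.pot_logc_expc]
  have := pot_sub_le h.mono x x'
  linarith

lemma dist_apply (x : ℝ) : dist (expc x) (expc (T x)) = |x - T x| := by
  refine le_antisymm (dist_expc_le _ _) (abs_le_of_sq_le_sq ?_ dist_nonneg)
  have h1 := pot_add_conj_le h.mono (expc x) (expc (T x))
  rw [h.pot_logc_expc, h.conj_apply] at h1
  linarith

lemma abs_sub_le_pi (x : ℝ) : |x - T x| ≤ π := h.dist_apply x ▸ dist_le_pi _ _

lemma integrable_sub_sq (μ : Measure S1) [IsFiniteMeasure μ] :
    Integrable (fun z => (logc z - T (logc z)) ^ 2 / 2) μ := by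
  refine Integrable.of_bound (((measurable_logc.sub
    (measurable_lift h.mono)).pow_const 2).div_const 2).aestronglyMeasurable (π ^ 2 / 2)
    (ae_of_all _ fun z => ?_)
  rw [Real.norm_of_nonneg (by positivity), ← sq_abs]
  have := pow_le_pow_left₀ (abs_nonneg _) (h.abs_sub_le_pi (logc z)) 2
  linarith

lemma mul_nonneg_of_slack_eq_zero {x y : ℝ} (hxy : slack T x y = 0) (x' : ℝ) :
    0 ≤ (x' - x) * (T x' - y) := by
  have h1 := h.pot_add_conj_le_sq x' y
  have h2 := pot_sub_le h.mono x' x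
  unfold slack at hxy
  nlinarith

lemma eq_of_slack_eq_zero {x y : ℝ} (hx : ContinuousAt T x) (hxy : slack T x y = 0) :
    y = T x := by
  have key := h.mul_nonneg_of_slack_eq_zero hxy
  apply le_antisymm
  · refine ge_of_tendsto (hx.tendsto.mono_left (nhdsWithin_le_nhds (s := Ioi x))) ?_
    filter_upwards [self_mem_nhdsWithin] with x' hx'
    exact sub_nonneg.1 (nonneg_of_mul_nonneg_right (key x') (sub_pos.2 hx'))
  · refine le_of_tendsto (hx.tendsto.mono_left (nhdsWithin_le_nhds (s := Iio x))) ?_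
    filter_upwards [self_mem_nhdsWithin] with x' hx'
    have h1 := key x'
    have h2 : x' < x := hx'
    by_contra! h3
    nlinarith

lemma continuous_slack (x : ℝ) : Continuous (slack T x) := by
  have := (continuous_conj h.mono).comp continuous_expc
  unfold slack
  fun_prop

lemma tendsto_of_tendsto_slack {x : ℝ} (hx : ContinuousAt T x) {y : ℕ → ℝ}
    (hy : ∀ n, |x - y n| ≤ π) (hs : Tendsto (fun n => slack T x (y n)) atTop (𝓝 0)) :
    Tendsto y atTop (𝓝 (T x)) := by
  refine (isCompact_Icc (a := x - π) (b := x + π)).tendsto_nhds_of_unique_mapClusterPt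
    (.of_forall fun n => ?_) fun c _ hc => h.eq_of_slack_eq_zero hx ?_
  · have := abs_le.1 (hy n)
    constructor <;> linarith
  · exact eq_of_nhds_neBot
      ((hc.continuousAt_comp (h.continuous_slack x).continuousAt).neBot.mono
        (inf_le_inf_left _ hs))

end IsCenteredLift

lemma integrable_dist_sq (γ : Measure (S1 × S1)) [IsFiniteMeasure γ] :
    Integrable (fun p => dist p.1 p.2 ^ 2) γ :=
  Continuous.integrable_of_hasCompactSupport (by fun_prop) (HasCompactSupport.of_compactSpace _)

lemma W2sq_le (γ : Measure (S1 × S1)) [IsProbabilityMeasure γ] :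
    W2sq (γ.map Prod.fst) (γ.map Prod.snd) ≤ ∫ p, dist p.1 p.2 ^ 2 ∂γ := by
  refine csInf_le ⟨0, ?_⟩ ⟨γ, inferInstance, rfl, rfl, rfl⟩
  rintro _ ⟨γ, -, -, -, rfl⟩
  positivity

lemma le_W2sq {μ ν : Measure S1} [IsProbabilityMeasure μ] [IsProbabilityMeasure ν] {c : ℝ}
    (h : ∀ γ : Measure (S1 × S1), IsProbabilityMeasure γ → γ.map Prod.fst = μ →
      γ.map Prod.snd = ν → c ≤ ∫ p, dist p.1 p.2 ^ 2 ∂γ) : c ≤ W2sq μ ν := by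
  refine le_csInf ⟨_, μ.prod ν, inferInstance, by simp, by simp, rfl⟩ ?_
  rintro _ ⟨γ, h1, h2, h3, rfl⟩
  exact h γ h1 h2 h3

lemma W2sq_map_map_le (μ : Measure S1) [IsProbabilityMeasure μ] {S S' : S1 → S1}
    (hS : Measurable S) (hS' : Measurable S') :
    W2sq (μ.map S) (μ.map S') ≤ ∫ z, dist (S z) (S' z) ^ 2 ∂μ := by
  have hm := hS.prodMk hS'
  have := Measure.isProbabilityMeasure_map (μ := μ) hm.aemeasurable
  have h := W2sq_le (μ.map fun z => (S z, S' z))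
  rwa [Measure.map_map measurable_fst hm, Measure.map_map measurable_snd hm,
    integral_map hm.aemeasurable (integrable_dist_sq _).aestronglyMeasurable] at h

lemma W2sq_nonneg (μ ν : Measure S1) : 0 ≤ W2sq μ ν := by
  refine Real.sInf_nonneg ?_
  rintro _ ⟨γ, -, -, -, rfl⟩
  positivity

/-- The easy half of Kantorovich–Rubinstein duality, combined with `W₁ ≤ W₂`. -/
lemma abs_integral_sub_le {φ : S1 → ℝ} (hφ : LipschitzWith ⟨π, pi_pos.le⟩ φ)
    (μ ν : Measure S1) [IsProbabilityMeasure μ] [IsProbabilityMeasure ν] :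
    |∫ z, φ z ∂μ - ∫ z, φ z ∂ν| ≤ π * √(W2sq μ ν) := by
  rw [← div_le_iff₀' pi_pos]
  refine Real.le_sqrt_of_sq_le (le_W2sq ?_)
  rintro γ hγ rfl rfl
  have hint : ∀ {f : S1 × S1 → ℝ}, Continuous f → Integrable f γ := fun hf =>
    hf.integrable_of_hasCompactSupport (HasCompactSupport.of_compactSpace _)
  have hφc := hφ.continuous
  rw [integral_map measurable_fst.aemeasurable hφc.aestronglyMeasurable,
    integral_map measurable_snd.aemeasurable hφc.aestronglyMeasurable,
    ← integral_sub (hint (by fun_prop)) (hint (by fun_prop))]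
  set m := ∫ p, dist p.1 p.2 ∂γ with hm
  have hdist : Integrable (fun p : S1 × S1 => dist p.1 p.2) γ := hint (by fun_prop)
  have h1 : |∫ p, (φ p.1 - φ p.2) ∂γ| / π ≤ m := by
    rw [div_le_iff₀' pi_pos, hm, ← integral_const_mul]
    refine abs_integral_le_integral_abs.trans (integral_mono (hint (by fun_prop))
      (hdist.const_mul _) fun p => ?_)
    exact hφ.dist_le_mul p.1 p.2
  have h2 : 0 ≤ ∫ p : S1 × S1, (dist p.1 p.2 - m) ^ 2 ∂γ := integral_nonneg fun _ => sq_nonneg _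
  have h3 : ∫ p : S1 × S1, (dist p.1 p.2 - m) ^ 2 ∂γ
      = ∫ p, dist p.1 p.2 ^ 2 ∂γ - m ^ 2 := by
    have h4 : ∀ p : S1 × S1, (dist p.1 p.2 - m) ^ 2
      = dist p.1 p.2 ^ 2 - 2 * m * dist p.1 p.2 + m ^ 2 := fun p => by ring
    simp_rw [h4]
    rw [integral_add (f := fun p : S1 × S1 => dist p.1 p.2 ^ 2 - 2 * m * dist p.1 p.2)
        ((integrable_dist_sq γ).sub (hdist.const_mul _)) (integrable_const _),
      integral_sub (integrable_dist_sq γ) (hdist.const_mul _), integral_const_mul, ← hm]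
    simp; ring
  have h5 := pow_le_pow_left₀ (by positivity) h1 2
  linarith

namespace IsCenteredLift

variable {T T' : ℝ → ℝ} (h : IsCenteredLift T) (h' : IsCenteredLift T')
  (μ : Measure S1) [IsProbabilityMeasure μ]

include h

lemma integral_dist_sq :
    ∫ z, dist z (expc (T (logc z))) ^ 2 ∂μ
      = 2 * (∫ z, pot T (logc z) ∂μ
        + ∫ z, conj T z ∂μ.map (fun z => expc (T (logc z)))) := by
  have hm := measurable_map h.mono
  have := Measure.isProbabilityMeasure_map (μ := μ) hm.aemeasurable
  have hg := integrable_conj h.mono (μ.map fun z => expc (T (logc z)))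
  have hg' : Integrable (fun z => conj T (expc (T (logc z)))) μ := hg.comp_measurable hm
  rw [integral_map hm.aemeasurable hg.aestronglyMeasurable,
    ← integral_add (integrable_pot h.mono μ) hg', ← integral_const_mul]
  refine integral_congr_ae (.of_forall fun z => ?_)
  have h1 := h.conj_apply (logc z)
  have h2 := h.dist_apply (logc z)
  rw [expc_logc] at h2
  simp only [h1, h2, sq_abs]
  ring

lemma integral_pot_add_conj_le (ν : Measure S1) [IsProbabilityMeasure ν] :
    2 * (∫ z, pot T (logc z) ∂μ + ∫ z, conj T z ∂ν) ≤ W2sq μ ν := by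
  refine le_W2sq ?_
  rintro γ hγ rfl rfl
  have hf := integrable_pot h.mono (γ.map Prod.fst)
  have hg := integrable_conj h.mono (γ.map Prod.snd)
  have hf' : Integrable (fun p : S1 × S1 => pot T (logc p.1)) γ :=
    hf.comp_measurable measurable_fst
  have hg' : Integrable (fun p : S1 × S1 => conj T p.2) γ := hg.comp_measurable measurable_snd
  rw [integral_map measurable_fst.aemeasurable hf.aestronglyMeasurable,
    integral_map measurable_snd.aemeasurable hg.aestronglyMeasurable,
    ← integral_add hf' hg', ← integral_const_mul]
  refine integral_mono ((hf'.add hg').const_mul 2) (integrable_dist_sq γ) fun p => ?_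
  have := pot_add_conj_le h.mono p.1 p.2
  change 2 * (pot T (logc p.1) + conj T p.2) ≤ _
  linarith

lemma isOTM : IsOTM μ (μ.map fun z => expc (T (logc z))) (fun z => expc (T (logc z))) := by
  have hm := measurable_map h.mono
  have := Measure.isProbabilityMeasure_map (μ := μ) hm.aemeasurable
  refine ⟨hm, rfl, le_antisymm ?_ ?_⟩
  · rw [h.integral_dist_sq]
    exact h.integral_pot_add_conj_le μ _
  · simpa using W2sq_map_map_le μ measurable_id hm

include h'

omit [IsProbabilityMeasure μ] in
lemma sq_sub_le (x : ℝ) : (T x - T' x) ^ 2 ≤ (2 * π) ^ 2 := by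
  have h1 := abs_le.1 (h.abs_sub_le_pi x)
  have h2 := abs_le.1 (h'.abs_sub_le_pi x)
  exact sq_le_sq' (by linarith [h1.2, h2.1]) (by linarith [h1.1, h2.2])

lemma integrable_slack : Integrable (fun z => slack T (logc z) (T' (logc z))) μ := by
  have hm := measurable_map h'.mono
  have := Measure.isProbabilityMeasure_map (μ := μ) hm.aemeasurable
  exact ((h'.integrable_sub_sq μ).sub (integrable_pot h.mono μ)).sub
    ((integrable_conj h.mono (μ.map fun z => expc (T' (logc z)))).comp_measurable hm)

lemma integrable_sq_sub : Integrable (fun z => (T (logc z) - T' (logc z)) ^ 2) μ := by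
  refine Integrable.of_bound (((measurable_lift h.mono).sub
    (measurable_lift h'.mono)).pow_const 2).aestronglyMeasurable ((2 * π) ^ 2)
    (ae_of_all _ fun z => ?_)
  rw [Real.norm_of_nonneg (by positivity)]
  exact h.sq_sub_le h' _

/-- Stability: the defect of `T'` for the potentials of `T` is controlled by the distance of
the two target measures. -/
lemma integral_slack_le {ν ν' : Measure S1} [IsProbabilityMeasure ν] [IsProbabilityMeasure ν']
    (hν : μ.map (fun z => expc (T (logc z))) = ν)
    (hν' : μ.map (fun z => expc (T' (logc z))) = ν') :
    ∫ z, slack T (logc z) (T' (logc z)) ∂μ ≤ 2 * π * √(W2sq ν' ν) := by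
  have hm' := measurable_map h'.mono
  have hg : Integrable (conj T) (μ.map fun z => expc (T' (logc z))) := by
    rw [hν']; exact integrable_conj h.mono ν'
  have e1 : ∫ z, slack T (logc z) (T' (logc z)) ∂μ
      = ∫ z, (logc z - T' (logc z)) ^ 2 / 2 ∂μ - ∫ z, pot T (logc z) ∂μ
        - ∫ z, conj T z ∂ν' := by
    have hg' : Integrable (fun z => conj T (expc (T' (logc z)))) μ := hg.comp_measurable hm'
    rw [← hν', integral_map hm'.aemeasurable hg.aestronglyMeasurable,
      ← integral_sub (h'.integrable_sub_sq μ) (integrable_pot h.mono μ)]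
    exact integral_sub ((h'.integrable_sub_sq μ).sub (integrable_pot h.mono μ)) hg'
  have e2 : ∫ z, (logc z - T' (logc z)) ^ 2 / 2 ∂μ
      = ∫ z, pot T' (logc z) ∂μ + ∫ z, conj T' z ∂ν' := by
    have := h'.integral_dist_sq μ
    rw [hν'] at this
    rw [integral_div, ← mul_div_cancel_left₀ (_ + _) (two_ne_zero' ℝ), ← this]
    congr 1
    refine integral_congr_ae (.of_forall fun z => ?_)
    have h2 := h'.dist_apply (logc z)
    rw [expc_logc] at h2
    simp only [h2, sq_abs]
  have e3 : 2 * (∫ z, pot T' (logc z) ∂μ + ∫ z, conj T' z ∂ν)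
      ≤ 2 * (∫ z, pot T (logc z) ∂μ + ∫ z, conj T z ∂ν) := by
    refine (h'.integral_pot_add_conj_le μ ν).trans (le_of_eq ?_)
    have h1 := (h.isOTM μ).2.2
    have h2 := h.integral_dist_sq μ
    rw [hν] at h1 h2
    rw [← h1, h2]
  have e4 := abs_le.1 (abs_integral_sub_le (lipschitzWith_conj h.mono) ν' ν)
  have e5 := abs_le.1 (abs_integral_sub_le (lipschitzWith_conj h'.mono) ν' ν)
  linarith [e4.1, e5.2]

end IsCenteredLift

lemma ae_continuousAt_logc {T : ℝ → ℝ} (hT : Monotone T) (μ : Measure S1)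
    [NullSingletonClass μ] : ∀ᵐ z ∂μ, ContinuousAt T (logc z) :=
  (hT.countable_not_continuousAt.preimage logc_injective).measure_zero μ

lemma tendsto_integral_sq_sub {μ : Measure S1} [IsProbabilityMeasure μ] [NullSingletonClass μ]
    {T : ℝ → ℝ} {Tn : ℕ → ℝ → ℝ} (h : IsCenteredLift T) (hn : ∀ n, IsCenteredLift (Tn n))
    (hs : Tendsto (fun n => ∫ z, slack T (logc z) (Tn n (logc z)) ∂μ) atTop (𝓝 0)) :
    Tendsto (fun n => ∫ z, (Tn n (logc z) - T (logc z)) ^ 2 ∂μ) atTop (𝓝 0) := by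
  refine tendsto_of_subseq_tendsto fun ns hns => ?_
  have hmeas : TendstoInMeasure μ (fun k z => slack T (logc z) (Tn (ns k) (logc z))) atTop
      (fun _ => 0) := by
    refine tendstoInMeasure_of_tendsto_eLpNorm one_ne_zero
      (fun k => (h.integrable_slack (hn _) μ).aestronglyMeasurable)
      aestronglyMeasurable_const ?_
    have : ∀ k, eLpNorm ((fun z => slack T (logc z) (Tn (ns k) (logc z))) - fun _ => 0) 1 μ
        = ENNReal.ofReal (∫ z, slack T (logc z) (Tn (ns k) (logc z)) ∂μ) := fun k => by
      rw [ofReal_integral_eq_lintegral_ofReal (h.integrable_slack (hn _) μ)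
        (.of_forall fun z => h.slack_nonneg _ _), eLpNorm_one_eq_lintegral_enorm]
      refine lintegral_congr fun z => ?_
      simp [Real.enorm_of_nonneg (h.slack_nonneg _ _)]
    simp_rw [this]
    simpa [Function.comp_def] using (ENNReal.continuous_ofReal.tendsto 0).comp (hs.comp hns)
  obtain ⟨ms, -, hms⟩ := hmeas.exists_seq_tendsto_ae
  refine ⟨ms, ?_⟩
  have hlim : Tendsto (fun k => ∫ z, (Tn (ns (ms k)) (logc z) - T (logc z)) ^ 2 ∂μ) atTop
      (𝓝 (∫ _, (0 : ℝ) ∂μ)) := by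
    refine tendsto_integral_of_dominated_convergence (fun _ => (2 * π) ^ 2)
      (fun k => (((measurable_lift (hn _).mono).sub
        (measurable_lift h.mono)).pow_const 2).aestronglyMeasurable) (integrable_const _)
      (fun k => .of_forall fun z => ?_) ?_
    · rw [Real.norm_of_nonneg (by positivity)]
      exact (hn _).sq_sub_le h _
    · filter_upwards [hms, ae_continuousAt_logc h.mono μ] with z hz hc
      have := h.tendsto_of_tendsto_slack hc (fun k => (hn (ns (ms k))).abs_sub_le_pi _) hz
      simpa using (this.sub_const (T (logc z))).pow 2
  simpa using hlim

/-- The extension `F` of `f : (0, p] → ℝ` to `ℝ` with `F (x + p) = F x + q`. -/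
def equivariantExt {p : ℝ} (hp : 0 < p) (q : ℝ) (f : ℝ → ℝ) (x : ℝ) : ℝ :=
  f (toIocMod hp 0 x) + toIocDiv hp 0 x * q

section EquivariantExt

variable {p : ℝ} (hp : 0 < p) {q : ℝ} {f : ℝ → ℝ}

lemma equivariantExt_add (x : ℝ) :
    equivariantExt hp q f (x + p) = equivariantExt hp q f x + q := by
  simp [equivariantExt, toIocDiv_add_right, toIocMod_add_right]
  ring

lemma equivariantExt_of_mem {x : ℝ} (hx : x ∈ Ioc 0 p) : equivariantExt hp q f x = f x := by
  have h1 : toIocDiv hp 0 x = 0 := toIocDiv_eq_of_sub_zsmul_mem_Ioc hp (by simpa using hx)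
  have h2 := toIocMod_add_toIocDiv_zsmul hp 0 x
  rw [h1, zero_smul, add_zero] at h2
  simp [equivariantExt, h1, h2]

lemma monotone_equivariantExt (hf : MonotoneOn f (Ioc 0 p)) (hmaps : MapsTo f (Ioc 0 p) (Icc 0 q)) :
    Monotone (equivariantExt hp q f) := by
  intro x y hxy
  have hx : toIocMod hp 0 x ∈ Ioc 0 p := by simpa using toIocMod_mem_Ioc hp 0 x
  have hy : toIocMod hp 0 y ∈ Ioc 0 p := by simpa using toIocMod_mem_Ioc hp 0 y
  have ex := toIocMod_add_toIocDiv_zsmul hp 0 x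
  have ey := toIocMod_add_toIocDiv_zsmul hp 0 y
  rw [zsmul_eq_mul] at ex ey
  have hq : 0 ≤ q := (hmaps hx).1.trans (hmaps hx).2
  unfold equivariantExt
  rcases lt_trichotomy (toIocDiv hp 0 x) (toIocDiv hp 0 y) with h | h | h
  · have h' : (toIocDiv hp 0 x : ℝ) + 1 ≤ toIocDiv hp 0 y := by exact_mod_cast h
    have := mul_le_mul_of_nonneg_right h' hq
    linarith [(hmaps hx).2, (hmaps hy).1]
  · rw [h] at ex ⊢
    linarith [hf hx hy (by linarith)]
  · have h' : (toIocDiv hp 0 y : ℝ) + 1 ≤ toIocDiv hp 0 x := by exact_mod_cast h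
    have := mul_le_mul_of_nonneg_right h' hp.le
    linarith [hx.1, hy.2]

end EquivariantExt

/-- The quantile function of a probability measure on `ℝ`. -/
def quantile (m : Measure ℝ) (u : ℝ) : ℝ := sInf {x | u ≤ ProbabilityTheory.cdf m x}

section Quantile

variable {m : Measure ℝ} [IsProbabilityMeasure m] (hm : ∀ᵐ x ∂m, x ∈ Ico 0 (2 * π))

include hm

lemma cdf_eq_zero_of_neg {x : ℝ} (hx : x < 0) : ProbabilityTheory.cdf m x = 0 := by
  rw [ProbabilityTheory.cdf_eq_real, measureReal_eq_zero_iff]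
  refine measure_mono_null (fun y hy => ?_) hm
  exact fun h => absurd (hy : y ≤ x) (not_le.2 (hx.trans_le h.1))

lemma cdf_two_pi : ProbabilityTheory.cdf m (2 * π) = 1 := by
  have : m (Iic (2 * π)) = 1 := by
    rw [prob_compl_eq_zero_iff measurableSet_Iic |>.symm]
    exact measure_mono_null (fun y hy => show ¬ y ∈ Ico 0 (2 * π) from fun h => hy h.2.le) hm
  rw [ProbabilityTheory.cdf_eq_real, measureReal_def, this, ENNReal.toReal_one]

lemma quantile_le_iff {u : ℝ} (hu : u ∈ Ioc 0 1) (x : ℝ) :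
    quantile m u ≤ x ↔ u ≤ ProbabilityTheory.cdf m x := by
  have hb : ∀ y ∈ {x | u ≤ ProbabilityTheory.cdf m x}, 0 ≤ y := fun y hy => by
    by_contra! h
    rw [mem_ofPred_eq, cdf_eq_zero_of_neg hm h] at hy
    exact absurd hu.1 hy.not_gt
  have hne : {x | u ≤ ProbabilityTheory.cdf m x}.Nonempty :=
    ⟨2 * π, hu.2.trans (cdf_two_pi hm).ge⟩
  refine ⟨fun h => ?_, fun h => csInf_le ⟨0, hb⟩ h⟩
  refine le_trans ?_ (ProbabilityTheory.monotone_cdf m h)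
  refine ge_of_tendsto (((ProbabilityTheory.cdf m).right_continuous (quantile m u)).mono
    Ioi_subset_Ici_self).tendsto ?_
  filter_upwards [self_mem_nhdsWithin] with y hy
  obtain ⟨y', hy', hlt⟩ := exists_lt_of_csInf_lt hne hy
  exact le_trans hy' (ProbabilityTheory.monotone_cdf m hlt.le)

lemma monotoneOn_quantile : MonotoneOn (quantile m) (Ioc 0 1) := fun _ hu _ hv huv =>
  (quantile_le_iff hm hu _).2 (huv.trans ((quantile_le_iff hm hv _).1 le_rfl))

lemma mapsTo_quantile : MapsTo (quantile m) (Ioc 0 1) (Icc 0 (2 * π)) := fun u hu => by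
  refine ⟨?_, (quantile_le_iff hm hu _).2 (hu.2.trans (cdf_two_pi hm).ge)⟩
  by_contra! h
  have := (quantile_le_iff hm hu _).1 le_rfl
  rw [cdf_eq_zero_of_neg hm h] at this
  exact absurd hu.1 this.not_gt

lemma aemeasurable_quantile : AEMeasurable (quantile m) (volume.restrict (Ioc 0 1)) :=
  aemeasurable_restrict_of_monotoneOn measurableSet_Ioc (monotoneOn_quantile hm)

lemma map_quantile : (volume.restrict (Ioc 0 1)).map (quantile m) = m := by
  refine (Measure.ext_of_Iic _ _ fun x => ?_).symm
  rw [Measure.map_apply_of_aemeasurable (aemeasurable_quantile hm) measurableSet_Iic,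
    ← ProbabilityTheory.ofReal_cdf, Measure.restrict_apply₀' nullMeasurableSet_Ioc]
  have : quantile m ⁻¹' Iic x ∩ Ioc 0 1 = Ioc 0 (ProbabilityTheory.cdf m x) := by
    ext u
    constructor
    · rintro ⟨h1, h2⟩
      exact ⟨h2.1, (quantile_le_iff hm h2 x).1 h1⟩
    · rintro ⟨h1, h2⟩
      have h3 : u ∈ Ioc (0 : ℝ) 1 := ⟨h1, h2.trans (ProbabilityTheory.cdf_le_one m x)⟩
      exact ⟨(quantile_le_iff hm h3 x).2 h2, h3⟩
  rw [this, Real.volume_Ioc, sub_zero]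

lemma cdf_quantile [NullSingletonClass m] {u : ℝ} (hu : u ∈ Ioc 0 1) :
    ProbabilityTheory.cdf m (quantile m u) = u := by
  refine le_antisymm ?_ ((quantile_le_iff hm hu _).1 le_rfl)
  have h1 := (ProbabilityTheory.cdf m).measure_singleton (quantile m u)
  rw [ProbabilityTheory.measure_cdf, measure_singleton, eq_comm, ENNReal.ofReal_eq_zero,
    sub_nonpos] at h1
  refine h1.trans (le_of_tendsto ((ProbabilityTheory.monotone_cdf m).tendsto_leftLim _) ?_)
  filter_upwards [self_mem_nhdsWithin] with y hy
  by_contra! h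
  exact absurd ((quantile_le_iff hm hu y).2 h.le) (not_le.2 hy)

lemma map_cdf [NullSingletonClass m] :
    m.map (ProbabilityTheory.cdf m) = volume.restrict (Ioc 0 1) := by
  have hc : Measurable (ProbabilityTheory.cdf m) := (ProbabilityTheory.monotone_cdf m).measurable
  conv_lhs => enter [2]; rw [← map_quantile hm]
  rw [AEMeasurable.map_map_of_aemeasurable hc.aemeasurable (aemeasurable_quantile hm)]
  refine (Measure.map_congr ?_).trans Measure.map_id
  filter_upwards [ae_restrict_mem measurableSet_Ioc] with u hu
  exact cdf_quantile hm hu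

end Quantile

section CenteredComposition

variable {a Q : ℝ → ℝ} (ha : Monotone a) (ha1 : ∀ x, a (x + 2 * π) = a x + 1) (ha0 : a 0 = 0)
  (hQ : Monotone Q) (hQ1 : ∀ u, Q (u + 1) = Q u + 2 * π) (hQ0 : Q 0 ≤ 0) (hQ1' : 0 ≤ Q 1)

lemma intervalIntegrable_sub_id (hT : Monotone Q) (b c : ℝ) :
    IntervalIntegrable (fun x => Q x - x) volume b c :=
  hT.intervalIntegrable.sub (continuous_id.intervalIntegrable _ _)

include hQ1 in
lemma leftLim_add_one (hQ : Monotone Q) (u : ℝ) :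
    Function.leftLim Q (u + 1) = Function.leftLim Q u + 2 * π := by
  refine leftLim_eq_of_tendsto ?_
  have h1 : Tendsto (fun v : ℝ => v - 1) (𝓝[<] (u + 1)) (𝓝[<] u) := by
    refine tendsto_nhdsWithin_of_tendsto_nhds_of_eventually_within _ ?_ ?_
    · exact (by simpa using (continuous_sub_right (1 : ℝ)).tendsto (u + 1) :
        Tendsto (fun v : ℝ => v - 1) (𝓝 (u + 1)) (𝓝 u)).mono_left nhdsWithin_le_nhds
    · filter_upwards [self_mem_nhdsWithin] with v hv
      have : v < u + 1 := hv
      change v - 1 < u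
      linarith
  refine (((hQ.tendsto_leftLim u).comp h1).add_const (2 * π)).congr fun v => ?_
  simp [← hQ1]

include hQ1 in
lemma rightLim_add_one (hQ : Monotone Q) (u : ℝ) :
    Function.rightLim Q (u + 1) = Function.rightLim Q u + 2 * π := by
  refine rightLim_eq_of_tendsto ?_
  have h1 : Tendsto (fun v : ℝ => v - 1) (𝓝[>] (u + 1)) (𝓝[>] u) := by
    refine tendsto_nhdsWithin_of_tendsto_nhds_of_eventually_within _ ?_ ?_
    · exact (by simpa using (continuous_sub_right (1 : ℝ)).tendsto (u + 1) :
        Tendsto (fun v : ℝ => v - 1) (𝓝 (u + 1)) (𝓝 u)).mono_left nhdsWithin_le_nhds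
    · filter_upwards [self_mem_nhdsWithin] with v hv
      have : u + 1 < v := hv
      change u < v - 1
      linarith
  refine (((hQ.tendsto_rightLim u).comp h1).add_const (2 * π)).congr fun v => ?_
  simp [← hQ1]

include ha hQ in
lemma tendsto_average {l : Filter ℝ} [l.IsCountablyGenerated] {θ : ℝ} (hl : l ≤ 𝓝 θ)
    {R : ℝ → ℝ} (hR : ∀ u, Tendsto (fun t => Q (u + t)) l (𝓝 (R u))) :
    Tendsto (fun t => ∫ x in (0:ℝ)..(2 * π), (Q (a x + t) - x)) l
      (𝓝 (∫ x in (0:ℝ)..(2 * π), (R (a x) - x))) := by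
  refine intervalIntegral.tendsto_integral_filter_of_dominated_convergence
    (fun _ => |Q (a 0 + (θ - 1))| + |Q (a (2 * π) + (θ + 1))| + 2 * π) (.of_forall fun t => ?_) ?_
    (by simp) (.of_forall fun x _ => (hR (a x)).sub_const x)
  · exact ((hQ.comp (ha.add_const t)).measurable.sub measurable_id).aestronglyMeasurable
  · filter_upwards [hl (Ioo_mem_nhds (sub_one_lt θ) (lt_add_one θ))] with t ht
    refine .of_forall fun x hx => ?_
    rw [uIoc_of_le (by positivity)] at hx
    have h1 : Q (a 0 + (θ - 1)) ≤ Q (a x + t) := hQ (by linarith [ha hx.1.le, ht.1])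
    have h2 : Q (a x + t) ≤ Q (a (2 * π) + (θ + 1)) := hQ (by linarith [ha hx.2, ht.2])
    rw [Real.norm_eq_abs, abs_le]
    constructor <;>
      linarith [neg_abs_le (Q (a 0 + (θ - 1))), le_abs_self (Q (a (2 * π) + (θ + 1))),
        abs_nonneg (Q (a 0 + (θ - 1))), abs_nonneg (Q (a (2 * π) + (θ + 1))), hx.1, hx.2]

include ha ha1 ha0 hQ hQ1 hQ0 hQ1' in
/-- Shifting the parameter and interpolating across a jump of `Q` produces a centered lift. -/
lemma exists_isCenteredLift : ∃ (θ : ℝ) (T : ℝ → ℝ), IsCenteredLift T ∧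
    ∀ x, ContinuousAt Q (a x + θ) → T x = Q (a x + θ) := by
  set A : ℝ → ℝ := fun t => ∫ x in (0:ℝ)..(2 * π), (Q (a x + t) - x)
  have hpi : (0 : ℝ) ≤ 2 * π := by positivity
  have hint : ∀ {R : ℝ → ℝ}, Monotone R →
      IntervalIntegrable (fun x => R (a x) - x) volume 0 (2 * π) :=
    fun hR => intervalIntegrable_sub_id (hR.comp ha) _ _
  have hintA : ∀ t, IntervalIntegrable (fun x => Q (a x + t) - x) volume 0 (2 * π) :=
    fun t => intervalIntegrable_sub_id (hQ.comp (ha.add_const t)) _ _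
  have hAmono : Monotone A := fun s t hst => intervalIntegral.integral_mono_on hpi (hintA s)
    (hintA t) fun x _ => by linarith [hQ (add_le_add_right hst (a x))]
  have ha2 : a (2 * π) = 1 := by simpa [ha0] using ha1 0
  have hbdd : ∀ t ∈ {t | A t < 0}, t ≤ 2 := fun t ht => by
    by_contra! h
    refine absurd (show A t < 0 from ht) (not_lt.2 (intervalIntegral.integral_nonneg hpi
      fun x hx => ?_))
    have h1 : Q 2 ≤ Q (a x + t) := hQ (by linarith [ha hx.1])
    have h2 : Q 2 = Q 1 + 2 * π := by rw [← hQ1]; norm_num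
    linarith [hx.2]
  have hne : A (-2) < 0 := by
    have h1 : A (-2) ≤ ∫ _ in (0:ℝ)..(2 * π), -(2 * π) := by
      refine intervalIntegral.integral_mono_on hpi (hintA _) (by simp) fun x hx => ?_
      have h1 : Q (a x + -2) ≤ Q (-1) := hQ (by linarith [ha hx.2])
      have h2 : Q 0 = Q (-1) + 2 * π := by rw [← hQ1]; norm_num
      linarith [hx.1]
    rw [intervalIntegral.integral_const, smul_eq_mul, sub_zero] at h1
    nlinarith [pi_pos]
  set θ := sSup {t | A t < 0}
  have hlt : ∀ t < θ, A t < 0 := fun t ht => by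
    obtain ⟨s, hs, hts⟩ := exists_lt_of_lt_csSup ⟨-2, hne⟩ ht
    exact (hAmono hts.le).trans_lt hs
  have hgt : ∀ t > θ, 0 ≤ A t := fun t ht => by
    by_contra! h
    exact absurd (le_csSup ⟨2, hbdd⟩ (show t ∈ {t | A t < 0} from h)) (not_le.2 ht)
  have hadd : ∀ u : ℝ, Tendsto (fun t => u + t) (𝓝 θ) (𝓝 (u + θ)) :=
    fun u => (continuous_const_add u).tendsto θ
  have hL : ∫ x in (0:ℝ)..(2 * π), (Function.leftLim Q (a x + θ) - x) ≤ 0 := by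
    refine le_of_tendsto (tendsto_average (l := 𝓝[<] θ) ha hQ nhdsWithin_le_nhds
      (R := fun u => Function.leftLim Q (u + θ)) fun u => ?_) ?_
    · refine (hQ.tendsto_leftLim (u + θ)).comp
        (tendsto_nhdsWithin_of_tendsto_nhds_of_eventually_within _
          ((hadd u).mono_left nhdsWithin_le_nhds) ?_)
      filter_upwards [self_mem_nhdsWithin] with t ht
      exact add_lt_add_right (show t < θ from ht) u
    · filter_upwards [self_mem_nhdsWithin] with t ht using (hlt t ht).le
  have hR : 0 ≤ ∫ x in (0:ℝ)..(2 * π), (Function.rightLim Q (a x + θ) - x) := by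
    refine ge_of_tendsto (tendsto_average (l := 𝓝[>] θ) ha hQ nhdsWithin_le_nhds
      (R := fun u => Function.rightLim Q (u + θ)) fun u => ?_) ?_
    · refine (hQ.tendsto_rightLim (u + θ)).comp
        (tendsto_nhdsWithin_of_tendsto_nhds_of_eventually_within _
          ((hadd u).mono_left nhdsWithin_le_nhds) ?_)
      filter_upwards [self_mem_nhdsWithin] with t ht
      exact add_lt_add_right (show θ < t from ht) u
    · filter_upwards [self_mem_nhdsWithin] with t ht using hgt t ht
  obtain ⟨c, d, hc, hd, hcd, h0⟩ := (segment_eq_Icc (hL.trans hR)).ge ⟨hL, hR⟩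
  have hmL : Monotone fun u => Function.leftLim Q (u + θ) :=
    hQ.leftLim.comp (monotone_id.add_const θ)
  have hmR : Monotone fun u => Function.rightLim Q (u + θ) :=
    hQ.rightLim.comp (monotone_id.add_const θ)
  refine ⟨θ, fun x => c * Function.leftLim Q (a x + θ) + d * Function.rightLim Q (a x + θ),
    ⟨fun x y hxy => ?_, fun x => ?_, ?_⟩, fun x hx => ?_⟩
  · exact add_le_add (mul_le_mul_of_nonneg_left (hmL (ha hxy)) hc)
      (mul_le_mul_of_nonneg_left (hmR (ha hxy)) hd)
  · have e : a (x + 2 * π) + θ = a x + θ + 1 := by rw [ha1]; ring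
    rw [e, leftLim_add_one hQ1 hQ, rightLim_add_one hQ1 hQ]
    linear_combination (2 * π) * hcd
  · rw [smul_eq_mul, smul_eq_mul, ← intervalIntegral.integral_const_mul,
      ← intervalIntegral.integral_const_mul,
      ← intervalIntegral.integral_add ((hint hmL).const_mul c) ((hint hmR).const_mul d)] at h0
    refine Eq.trans (intervalIntegral.integral_congr fun x _ => ?_) h0
    change c * _ + d * _ - x = c * (_ - x) + d * (_ - x)
    linear_combination x * hcd
  · have h1 := hQ.continuousAt_iff_leftLim_eq_rightLim.1 hx
    have h2 : Function.leftLim Q (a x + θ) = Q (a x + θ) :=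
      le_antisymm (hQ.leftLim_le le_rfl) (h1 ▸ hQ.le_rightLim le_rfl)
    simp only [← h1, h2]
    linear_combination Q (a x + θ) * hcd

end CenteredComposition

lemma map_add_restrict_Ioc {β : Type*} [MeasurableSpace β] {g : ℝ → β} (hg : Measurable g)
    (hper : Function.Periodic g 1) (θ : ℝ) :
    (volume.restrict (Ioc (0 : ℝ) 1)).map (fun u => g (u + θ))
      = (volume.restrict (Ioc (0 : ℝ) 1)).map g := by
  have e : (volume.restrict (Ioc (0 : ℝ) 1)).map (fun u => u + θ)
      = volume.restrict (Ioc θ (θ + 1)) := by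
    have h := (measurePreserving_add_right volume θ).restrict_preimage
      (measurableSet_Ioc (a := θ) (b := θ + 1))
    have h' : (fun u : ℝ => u + θ) ⁻¹' Ioc θ (θ + 1) = Ioc 0 1 := by
      ext u; simp [add_comm]
    rw [h'] at h
    exact h.map_eq
  rw [show (fun u => g (u + θ)) = g ∘ fun u => u + θ from rfl,
    ← Measure.map_map hg (measurable_add_const θ), e]
  ext s hs
  rw [Measure.map_apply hg hs, Measure.map_apply hg hs, Measure.restrict_apply (hg hs),
    Measure.restrict_apply (hg hs)]
  have h := (isAddFundamentalDomain_Ioc one_pos θ).measure_set_eq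
    (isAddFundamentalDomain_Ioc one_pos 0) (hg hs) fun ⟨_, k, hk⟩ => ?_
  · simpa using h
  · ext u
    have : g (k • (1 : ℝ) + u) = g u := by
      rw [add_comm]; exact hper.zsmul k u
    change g (_ + u) ∈ s ↔ g u ∈ s
    rw [← this]; simp only [← hk]

lemma ae_mem_Ico_tilde (μ : Measure S1) : ∀ᵐ x ∂tilde μ, x ∈ Ico 0 (2 * π) :=
  (ae_map_iff measurable_logc.aemeasurable measurableSet_Ico).2 (.of_forall logc_mem)

lemma exists_isCenteredLift_map_eq (μ ν : Measure S1) [IsProbabilityMeasure μ]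
    [IsProbabilityMeasure ν] [NullSingletonClass μ] :
    ∃ T, IsCenteredLift T ∧ μ.map (fun z => expc (T (logc z))) = ν := by
  have := nullSingletonClass_tilde μ
  have hμ := ae_mem_Ico_tilde μ
  have hν := ae_mem_Ico_tilde ν
  have h2π : (0 : ℝ) < 2 * π := by positivity
  set F := ProbabilityTheory.cdf (tilde μ)
  set a := equivariantExt h2π 1 F
  set Q := equivariantExt one_pos (2 * π) (quantile (tilde ν))
  have ha : Monotone a := monotone_equivariantExt _
    ((ProbabilityTheory.monotone_cdf _).monotoneOn _) fun x _ =>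
      ⟨ProbabilityTheory.cdf_nonneg _ x, ProbabilityTheory.cdf_le_one _ x⟩
  have hQ : Monotone Q := monotone_equivariantExt _ (monotoneOn_quantile hν) (mapsTo_quantile hν)
  have ha1 : ∀ x, a (x + 2 * π) = a x + 1 := equivariantExt_add _
  have hQ1 : ∀ x, Q (x + 1) = Q x + 2 * π := equivariantExt_add _
  have hone : (1 : ℝ) ∈ Ioc 0 1 := by simp
  have eQ1 : Q 1 = quantile (tilde ν) 1 := equivariantExt_of_mem _ hone
  have hq1 := mapsTo_quantile hν hone
  have hQ01 : Q 1 = Q 0 + 2 * π := by simpa using hQ1 0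
  have ha0 : a 0 = 0 := by
    have h1 : a (2 * π) = 1 :=
      (equivariantExt_of_mem h2π (right_mem_Ioc.2 h2π)).trans (cdf_two_pi hμ)
    have h2 := ha1 0
    rw [zero_add, h1] at h2
    linarith
  obtain ⟨θ, T, hT, hTQ⟩ := exists_isCenteredLift ha ha1 ha0 hQ hQ1
    (by linarith [hq1.2]) (by linarith [hq1.1])
  refine ⟨T, hT, ?_⟩
  have hmapa : (tilde μ).map a = volume.restrict (Ioc 0 1) := by
    rw [← map_cdf hμ]
    refine Measure.map_congr ?_
    filter_upwards [hμ, (measure_eq_zero_iff_ae_notMem.1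
      (measure_singleton (μ := tilde μ) (0 : ℝ)))] with x hx hx0
    exact equivariantExt_of_mem h2π ⟨lt_of_le_of_ne hx.1 (Ne.symm hx0), hx.2.le⟩
  have hTae : T =ᵐ[tilde μ] fun x => Q (a x + θ) := by
    have hcount : {u | ¬ ContinuousAt Q (u + θ)}.Countable :=
      hQ.countable_not_continuousAt.preimage (add_left_injective θ)
    have h0 : (tilde μ).map a {u | ¬ ContinuousAt Q (u + θ)} = 0 := by
      rw [hmapa]; exact hcount.measure_zero _
    have h1 := (Measure.map_apply ha.measurable hcount.measurableSet).symm.trans h0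
    filter_upwards [measure_eq_zero_iff_ae_notMem.1 h1] with x hx
    exact hTQ x (not_not.1 hx)
  have hg : Measurable fun u => expc (Q u) := measurable_expc.comp hQ.measurable
  calc μ.map (fun z => expc (T (logc z)))
      = (tilde μ).map (fun x => expc (T x)) :=
        (Measure.map_map (measurable_expc.comp hT.mono.measurable) measurable_logc).symm
    _ = (tilde μ).map (fun x => expc (Q (a x + θ))) :=
        Measure.map_congr (hTae.fun_comp expc)
    _ = ((tilde μ).map a).map (fun u => expc (Q (u + θ))) :=
        (Measure.map_map (hg.comp (measurable_add_const θ)) ha.measurable).symm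
    _ = (volume.restrict (Ioc 0 1)).map (fun u => expc (Q u)) := by
        rw [hmapa]
        refine map_add_restrict_Ioc hg (fun u => ?_) θ
        change expc (Q (u + 1)) = expc (Q u)
        rw [hQ1]
        exact (expc_eq_iff.2 ⟨1, by push_cast; ring⟩).symm
    _ = (volume.restrict (Ioc 0 1)).map (expc ∘ quantile (tilde ν)) := by
        refine Measure.map_congr ?_
        filter_upwards [ae_restrict_mem measurableSet_Ioc] with u hu
        exact congrArg expc (equivariantExt_of_mem one_pos hu)
    _ = ν := by
        rw [← AEMeasurable.map_map_of_aemeasurable measurable_expc.aemeasurable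
          (aemeasurable_quantile hν), map_quantile hν, map_expc_tilde]

/-- The logarithmic map `log_μ` is a homeomorphism from
`(𝒲₂(S¹), W₂)` onto its image in `L²(μ̃)`, with inverse `exp_μ`: there is an assignment
`ν ↦ L ν` of lifts of optimal transport maps which is injective (up to `L²(μ̃)`-equality),
whose inverse is `exp_μ` (i.e. `(exp_c ∘ L ν ∘ log_c) # μ = ν`), and such that convergence
in `W₂` is equivalent to convergence of the lifts in `L²(μ̃)`. -/
theorem stmt6 (μ : Measure S1) [IsProbabilityMeasure μ] (hac : μ ≪ volume) :
    ∃ L : {ν : Measure S1 // IsProbabilityMeasure ν} → (ℝ → ℝ),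
      (∀ ν : {ν : Measure S1 // IsProbabilityMeasure ν}, IsOTMLift μ ν.1 (L ν)) ∧
      (∀ ν₁ ν₂ : {ν : Measure S1 // IsProbabilityMeasure ν},
        (∫ x, (L ν₁ x - L ν₂ x) ^ 2 ∂(tilde μ)) = 0 → ν₁ = ν₂) ∧
      (∀ (νs : ℕ → {ν : Measure S1 // IsProbabilityMeasure ν})
         (ν : {ν : Measure S1 // IsProbabilityMeasure ν}),
        Tendsto (fun n => Real.sqrt (W2sq (νs n).1 ν.1)) atTop (𝓝 0) ↔
        Tendsto (fun n => ∫ x, (L (νs n) x - L ν x) ^ 2 ∂(tilde μ)) atTop (𝓝 0)) := by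
  have := nullSingletonClass_of_absolutelyContinuous hac
  have hex : ∀ ν : {ν : Measure S1 // IsProbabilityMeasure ν}, ∃ T, IsCenteredLift T ∧
      μ.map (fun z => expc (T (logc z))) = ν.1 := fun ν =>
    have := ν.2
    exists_isCenteredLift_map_eq μ ν.1
  choose L hL hmap using hex
  have hsq : ∀ ν₁ ν₂, ∫ x, (L ν₁ x - L ν₂ x) ^ 2 ∂(tilde μ)
      = ∫ z, (L ν₁ (logc z) - L ν₂ (logc z)) ^ 2 ∂μ := fun ν₁ ν₂ =>
    integral_map measurable_logc.aemeasurable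
      (((hL ν₁).mono.measurable.sub (hL ν₂).mono.measurable).pow_const 2).aestronglyMeasurable
  have hint := fun ν₁ ν₂ => (hL ν₁).integrable_sq_sub (hL ν₂) μ
  refine ⟨L, fun ν => ⟨(hL ν).mono, (hL ν).add_period, (hL ν).average, ?_⟩, fun ν₁ ν₂ h0 => ?_,
    fun νs ν => ⟨fun h => ?_, fun h => ?_⟩⟩
  · simpa only [hmap ν] using (hL ν).isOTM μ
  · rw [hsq, integral_eq_zero_iff_of_nonneg (fun _ => sq_nonneg _) (hint ν₁ ν₂)] at h0
    refine Subtype.ext ?_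
    rw [← hmap ν₁, ← hmap ν₂]
    refine Measure.map_congr ?_
    filter_upwards [h0] with z hz
    rw [sub_eq_zero.1 (pow_eq_zero_iff two_ne_zero |>.1 hz)]
  · simp_rw [hsq]
    refine tendsto_integral_sq_sub (hL ν) (fun n => hL (νs n)) ?_
    refine squeeze_zero (fun n => integral_nonneg fun z => (hL ν).slack_nonneg _ _) (fun n => ?_)
      (by simpa using h.const_mul (2 * π))
    have := ν.2
    have := (νs n).2
    exact (hL ν).integral_slack_le (hL (νs n)) μ (hmap ν) (hmap (νs n))
  · simp_rw [hsq] at h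
    have hW : Tendsto (fun n => W2sq (νs n).1 ν.1) atTop (𝓝 0) := by
      refine squeeze_zero (fun n => W2sq_nonneg _ _) (fun n => ?_) h
      rw [← hmap (νs n), ← hmap ν]
      have hm := measurable_map (hL (νs n)).mono
      have hm' := measurable_map (hL ν).mono
      refine (W2sq_map_map_le μ hm hm').trans (integral_mono_of_nonneg
        (.of_forall fun z => sq_nonneg _) (hint _ _) (.of_forall fun z => ?_))
      simpa only [sq_abs] using pow_le_pow_left₀ dist_nonneg (dist_expc_le _ _) 2
    simpa using hW.sqrt

end
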